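/- (Sufficient condition for dyadic balls.) Let d ∈ ℕ, 1 ≤ q ≤ ∞, s > 0 and set C(s) := 2^s/(1 − 2^{−s}). Define B_m := {k ∈ ℤ^d : |k| < 2^m} for m ∈ ℕ₀. For each m ∈ ℕ₀ let (a_{k,m})_{k ∈ ℤ^d} be a complex sequence supported in B_m (i.e. a_{k,m} = 0 for k ∉ B_m). Suppose there are N ≥ 0 and nonnegative reals (C_m)_{m ∈ ℕ₀} with ‖(C_m)‖_{ℓ^q(ℕ₀)} ≤ 1 such that ‖(a_{k,m})_{k ∈ ℤ^d}‖_{ℓ^q(ℤ^d)} ≤ (1/C(s)) 2^{−ms} C_m N for every m ∈ ℕ₀. Then for every k ∈ ℤ^d the series a_k := ∑_{m=0}^∞ a_{k,m} converges absolutely, and ‖(a_k)‖_{q,s} ≤ N. -/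

import Mathlib

open scoped ENNReal NNReal

/-- The Japanese bracket `⟨k⟩ = (1 + |k|²)^(1/2)` of a lattice point `k ∈ ℤ^d`. -/
noncomputable def jb {d : ℕ} (k : Fin d → ℤ) : ℝ :=
  Real.sqrt (1 + ∑ i, ((k i : ℝ)) ^ 2)

/-- Unweighted `ℓ^q` norm (`q ∈ [1,∞]`) of a real-valued family, valued in `ℝ≥0∞`. -/
noncomputable def lqNorm {ι : Type*} (q : ℝ≥0∞) (f : ι → ℝ) : ℝ≥0∞ :=
  if q = ∞ then ⨆ i, (‖f i‖₊ : ℝ≥0∞)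
  else (∑' i, (‖f i‖₊ : ℝ≥0∞) ^ q.toReal) ^ (1 / q.toReal)

/-- The weighted norm `‖a‖_{q,s}` on sequences `a : ℤ^d → ℂ`. -/
noncomputable def wnorm (d : ℕ) (q : ℝ≥0∞) (s : ℝ) (a : (Fin d → ℤ) → ℂ) : ℝ≥0∞ :=
  lqNorm q (fun k => jb k ^ s * ‖a k‖)

/-- `s` is sufficiently large: `s > d(1 - 1/q)` if `q > 1`, `s ≥ 0` if `q = 1`.
(For `q = ∞` one has `q.toReal = 0` and `1/0 = 0` in `ℝ`, so the condition reads `s > d`.) -/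
def SuffLarge (d : ℕ) (q : ℝ≥0∞) (s : ℝ) : Prop :=
  if q = 1 then 0 ≤ s else (d : ℝ) * (1 - 1 / q.toReal) < s


/-- The Euclidean length `|k|` of a lattice point `k ∈ ℤ^d`. -/
noncomputable def inorm {d : ℕ} (k : Fin d → ℤ) : ℝ :=
  Real.sqrt (∑ i, ((k i : ℝ)) ^ 2)

/-- The dyadic balls `B_m = {k ∈ ℤ^d : |k| < 2^m}`. -/
def dball (d m : ℕ) : Set (Fin d → ℤ) :=
  {k | inorm k < (2 : ℝ) ^ m}

/-- The `ℓ^q` norm of a family of extended nonnegative reals. -/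
noncomputable def elq {ι : Type*} (q : ℝ≥0∞) (f : ι → ℝ≥0∞) : ℝ≥0∞ :=
  if q = ∞ then ⨆ i, f i else (∑' i, f i ^ q.toReal) ^ (1 / q.toReal)

lemma lqNorm_eq_elq {ι : Type*} (q : ℝ≥0∞) (f : ι → ℝ) : lqNorm q f = elq q (fun i => ‖f i‖ₑ) :=
  rfl

section elq

variable {ι κ : Type*} {q : ℝ≥0∞}

lemma elq_mono {f g : ι → ℝ≥0∞} (h : ∀ i, f i ≤ g i) : elq q f ≤ elq q g := by
  unfold elq
  split_ifs with hq
  · exact iSup_mono h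
  · gcongr with i
    exact h i

lemma le_elq (hq : q ≠ 0) (f : ι → ℝ≥0∞) (i : ι) : f i ≤ elq q f := by
  unfold elq
  split_ifs with hq'
  · exact le_iSup f i
  · have hp : 0 < q.toReal := ENNReal.toReal_pos hq hq'
    rw [one_div, ENNReal.le_rpow_inv_iff hp]
    exact ENNReal.le_tsum i

lemma elq_const_mul (hq : q ≠ 0) (c : ℝ≥0∞) (f : ι → ℝ≥0∞) :
    elq q (fun i => c * f i) = c * elq q f := by
  unfold elq
  split_ifs with hq'
  · exact (ENNReal.mul_iSup c f).symm
  · have hp : 0 < q.toReal := ENNReal.toReal_pos hq hq'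
    simp_rw [ENNReal.mul_rpow_of_nonneg _ _ hp.le]
    rw [ENNReal.tsum_mul_left, ENNReal.mul_rpow_of_nonneg _ _ (by positivity), one_div,
      ENNReal.rpow_rpow_inv hp.ne']

lemma elq_comp_le {e : ι → κ} (he : Function.Injective e) (f : κ → ℝ≥0∞) :
    elq q (fun i => f (e i)) ≤ elq q f := by
  unfold elq
  split_ifs with hq
  · exact iSup_comp_le f e
  · gcongr
    exact ENNReal.tsum_comp_le_tsum_of_injective he (fun k => f k ^ q.toReal)

/-- The norm of a selection `k ↦ G (n k) k` is at most the mixed norm of `G`. -/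
lemma elq_diag_le (hq : q ≠ 0) (n : κ → ι) (G : ι → κ → ℝ≥0∞) :
    elq q (fun k => G (n k) k) ≤ elq q (fun i => elq q (G i)) := by
  unfold elq
  split_ifs with hq'
  · exact iSup_le fun k => (le_iSup (G (n k)) k).trans (le_iSup (fun i => ⨆ k, G i k) (n k))
  · have hp : 0 < q.toReal := ENNReal.toReal_pos hq hq'
    simp_rw [one_div, ENNReal.rpow_inv_rpow hp.ne']
    gcongr
    rw [ENNReal.tsum_comm]
    exact ENNReal.tsum_le_tsum fun k => ENNReal.le_tsum (f := fun i => G i k ^ q.toReal) (n k)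

lemma ENNReal.Lp_sum_le {p : ℝ} (hp : 1 ≤ p) (s : Finset κ) (t : Finset ι)
    (g : ι → κ → ℝ≥0∞) :
    (∑ k ∈ s, (∑ j ∈ t, g j k) ^ p) ^ (1 / p) ≤ ∑ j ∈ t, (∑ k ∈ s, g j k ^ p) ^ (1 / p) := by
  classical
  have hp0 : 0 < p := one_pos.trans_le hp
  induction t using Finset.induction_on with
  | empty => simp [hp0]
  | insert j t hj ih =>
    simp_rw [Finset.sum_insert hj]
    exact (ENNReal.Lp_add_le s _ _ hp).trans (by gcongr)

/-- Minkowski's inequality for countable sums. -/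
lemma elq_tsum_le (hq : 1 ≤ q) (g : ℕ → κ → ℝ≥0∞) :
    elq q (fun k => ∑' j, g j k) ≤ ∑' j, elq q (g j) := by
  unfold elq
  split_ifs with hq'
  · exact iSup_le fun k => ENNReal.tsum_le_tsum fun j => le_iSup (g j) k
  · have hp : 1 ≤ q.toReal := by
      simpa using ENNReal.toReal_mono hq' hq
    have hp0 : 0 < q.toReal := one_pos.trans_le hp
    rw [one_div, ENNReal.rpow_inv_le_iff hp0, ENNReal.tsum_eq_iSup_sum]
    refine iSup_le fun s => ?_
    have hlim : Filter.Tendsto (fun J : ℕ => ∑ k ∈ s, (∑ j ∈ Finset.range J, g j k) ^ q.toReal)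
        Filter.atTop (nhds (∑ k ∈ s, (∑' j, g j k) ^ q.toReal)) :=
      tendsto_finsetSum s fun k _ =>
        (ENNReal.continuous_rpow_const.tendsto _).comp (ENNReal.tendsto_nat_tsum fun j => g j k)
    refine le_of_tendsto' hlim fun J => ?_
    rw [← ENNReal.rpow_inv_le_iff hp0, ← one_div]
    refine (ENNReal.Lp_sum_le hp s (Finset.range J) g).trans ?_
    refine le_trans (Finset.sum_le_sum fun j _ => ?_) (ENNReal.sum_le_tsum (Finset.range J))
    gcongr
    exact ENNReal.sum_le_tsum s

end elq

lemma one_le_jb {d : ℕ} (k : Fin d → ℤ) : 1 ≤ jb k := by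
  rw [jb, Real.one_le_sqrt]
  exact le_add_of_nonneg_right (Finset.sum_nonneg fun i _ => sq_nonneg _)

lemma jb_le_of_mem_dball {d m : ℕ} {k : Fin d → ℤ} (hk : k ∈ dball d m) :
    jb k ≤ (2 : ℝ) ^ m := by
  have h1 : Real.sqrt (∑ i, ((k i : ℝ)) ^ 2) < (2 : ℝ) ^ m := hk
  rw [Real.sqrt_lt' (by positivity)] at h1
  rw [jb, Real.sqrt_le_left (by positivity)]
  have h2 : ∑ i, (k i) ^ 2 < ((2 : ℤ) ^ m) ^ 2 := by exact_mod_cast h1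
  have h3 : 1 + ∑ i, (k i) ^ 2 ≤ ((2 : ℤ) ^ m) ^ 2 := by lia
  exact_mod_cast h3

/-- Every lattice point has a dyadic level bounding its bracket, below which no ball contains it. -/
lemma exists_dyadic_level {d : ℕ} (k : Fin d → ℤ) :
    ∃ n : ℕ, jb k ≤ (2 : ℝ) ^ n ∧ ∀ m, k ∈ dball d m → n ≤ m := by
  classical
  have hex : ∃ n : ℕ, jb k ≤ (2 : ℝ) ^ n := (pow_unbounded_of_one_lt (jb k) one_lt_two).imp
    fun _ => le_of_lt
  exact ⟨Nat.find hex, Nat.find_spec hex, fun m hm => Nat.find_min' hex (jb_le_of_mem_dball hm)⟩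

lemma tsum_ofReal_geometric_le {s N : ℝ} (hs : 0 < s) (hN : 0 ≤ N) :
    ∑' j : ℕ, ENNReal.ofReal ((1 - (2 : ℝ) ^ (-s)) / (2 : ℝ) ^ s * (2 : ℝ) ^ (-(j : ℝ) * s) * N)
      ≤ ENNReal.ofReal N := by
  have hr0 : 0 < (2 : ℝ) ^ (-s) := by positivity
  have hr1 : (2 : ℝ) ^ (-s) < 1 := Real.rpow_lt_one_of_one_lt_of_neg one_lt_two (by linarith)
  have h2s : 1 ≤ (2 : ℝ) ^ s := Real.one_le_rpow one_le_two hs.le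
  have hpow (j : ℕ) : (2 : ℝ) ^ (-(j : ℝ) * s) = ((2 : ℝ) ^ (-s)) ^ j := by
    rw [← Real.rpow_mul_natCast zero_le_two]
    ring_nf
  simp_rw [hpow]
  set r := (2 : ℝ) ^ (-s)
  have hr : 0 < 1 - r := by linarith
  have hsum : HasSum (fun j : ℕ => (1 - r) / 2 ^ s * r ^ j * N) (N / 2 ^ s) := by
    convert! ((hasSum_geometric_of_lt_one hr0.le hr1).mul_left ((1 - r) / 2 ^ s)).mul_right N using 1
    field_simp
  rw [← ENNReal.ofReal_tsum_of_nonneg (fun j => by positivity) hsum.summable, hsum.tsum_eq]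
  exact ENNReal.ofReal_le_ofReal (div_le_self hN h2s)

lemma ENNReal.tsum_nat_add_of_eq_zero {f : ℕ → ℝ≥0∞} {n : ℕ} (hf : ∀ m < n, f m = 0) :
    ∑' j, f (j + n) = ∑' m, f m := by
  rw [← (ENNReal.summable (f := fun j => f (j + n))).sum_add_tsum_nat_add',
    Finset.sum_eq_zero fun m hm => hf m (Finset.mem_range.1 hm), zero_add]

lemma ofReal_dyadic_mul {K N c : ℝ} (s : ℝ) (hK : 0 ≤ K) (hN : 0 ≤ N) (hc : 0 ≤ c) (i j : ℕ) :
    ENNReal.ofReal ((2 : ℝ) ^ (i * s)) *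
        ENNReal.ofReal (K * (2 : ℝ) ^ (-((j + i : ℕ) : ℝ) * s) * c * N) =
      ENNReal.ofReal (K * (2 : ℝ) ^ (-(j : ℝ) * s) * N) * ‖c‖ₑ := by
  have hpow : (2 : ℝ) ^ (i * s) * (2 : ℝ) ^ (-((j + i : ℕ) : ℝ) * s) =
      (2 : ℝ) ^ (-(j : ℝ) * s) := by
    rw [← Real.rpow_add two_pos]
    push_cast
    ring_nf
  rw [Real.enorm_of_nonneg hc, ← ENNReal.ofReal_mul (by positivity),
    ← ENNReal.ofReal_mul (by positivity), ← hpow]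
  ring_nf

/-- sufficient condition for dyadic balls.
Here `1/C(s) = (1 - 2^(-s))/2^s`. -/
theorem sufficient_condition_balls (d : ℕ) (hd : 1 ≤ d) (q : ℝ≥0∞) (hq : 1 ≤ q)
    (s : ℝ) (hs : 0 < s) (a : ℕ → (Fin d → ℤ) → ℂ)
    (hsupp : ∀ m, ∀ k, k ∉ dball d m → a m k = 0)
    (N : ℝ) (hN : 0 ≤ N) (C : ℕ → ℝ) (hC : ∀ m, 0 ≤ C m) (hCnorm : lqNorm q C ≤ 1)
    (h : ∀ m : ℕ, lqNorm q (fun k => ‖a m k‖) ≤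
      ENNReal.ofReal ((1 - (2 : ℝ) ^ (-s)) / (2 : ℝ) ^ s *
        (2 : ℝ) ^ (-(m : ℝ) * s) * C m * N)) :
    (∀ k : Fin d → ℤ, Summable fun m => ‖a m k‖) ∧
      wnorm d q s (fun k => ∑' m, a m k) ≤ ENNReal.ofReal N := by
  have hq0 : q ≠ 0 := (one_pos.trans_le hq).ne'
  choose n hjb hn using fun k : Fin d → ℤ => exists_dyadic_level k
  set K := (1 - (2 : ℝ) ^ (-s)) / (2 : ℝ) ^ s
  have hK0 : 0 ≤ K := div_nonneg (sub_nonneg.2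
    (Real.rpow_le_one_of_one_le_of_nonpos one_le_two (by linarith))) (by positivity)
  let G (j i : ℕ) (k : Fin d → ℤ) : ℝ≥0∞ := ENNReal.ofReal ((2 : ℝ) ^ (i * s)) * ‖a (j + i) k‖ₑ
  have hGi (j i : ℕ) : elq q (G j i) ≤
      ENNReal.ofReal (K * (2 : ℝ) ^ (-(j : ℝ) * s) * N) * ‖C (j + i)‖ₑ := by
    have ha : elq q (fun k => ‖a (j + i) k‖ₑ) ≤
        ENNReal.ofReal (K * (2 : ℝ) ^ (-((j + i : ℕ) : ℝ) * s) * C (j + i) * N) := by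
      simpa [lqNorm_eq_elq] using h (j + i)
    refine (elq_const_mul hq0 _ _).trans_le ((mul_le_mul_right ha _).trans_eq ?_)
    exact ofReal_dyadic_mul s hK0 hN (hC (j + i)) i j
  have hG (j : ℕ) : elq q (fun k => G j (n k) k) ≤
      ENNReal.ofReal (K * (2 : ℝ) ^ (-(j : ℝ) * s) * N) := by
    calc elq q (fun k => G j (n k) k)
        ≤ elq q (fun i => elq q (G j i)) := elq_diag_le hq0 n (G j)
      _ ≤ elq q (fun i => ENNReal.ofReal (K * (2 : ℝ) ^ (-(j : ℝ) * s) * N) * ‖C (j + i)‖ₑ) :=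
          elq_mono (hGi j)
      _ = ENNReal.ofReal (K * (2 : ℝ) ^ (-(j : ℝ) * s) * N) * elq q (fun i => ‖C (j + i)‖ₑ) :=
          elq_const_mul hq0 _ _
      _ ≤ ENNReal.ofReal (K * (2 : ℝ) ^ (-(j : ℝ) * s) * N) * 1 := by
          gcongr
          exact (elq_comp_le (add_right_injective j) fun m => ‖C m‖ₑ).trans hCnorm
      _ = _ := mul_one _
  have hnorm : elq q (fun k => ∑' j, G j (n k) k) ≤ ENNReal.ofReal N :=
    (elq_tsum_le hq fun j k => G j (n k) k).trans
      ((ENNReal.tsum_le_tsum hG).trans (tsum_ofReal_geometric_le hs hN))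
  have htsum (k : Fin d → ℤ) : ∑' j, G j (n k) k =
      ENNReal.ofReal ((2 : ℝ) ^ (n k * s)) * ∑' m, ‖a m k‖ₑ := by
    have hshift : ∑' j, ‖a (j + n k) k‖ₑ = ∑' m, ‖a m k‖ₑ :=
      ENNReal.tsum_nat_add_of_eq_zero (f := fun m => ‖a m k‖ₑ) fun m hm => by
        have hmk : k ∉ dball d m := fun hk => hm.not_ge (hn k m hk)
        simp only [hsupp m k hmk, enorm_zero]
    rw [← hshift]
    exact ENNReal.tsum_mul_left
  have hpow_ge (k : Fin d → ℤ) : jb k ^ s ≤ (2 : ℝ) ^ (n k * s) := by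
    rw [Real.rpow_mul zero_le_two, Real.rpow_natCast]
    exact Real.rpow_le_rpow (zero_le_one.trans (one_le_jb k)) (hjb k) hs.le
  refine ⟨fun k => ?_, ?_⟩
  · rw [← tsum_enorm_ne_top_iff_summable_norm]
    refine ne_top_of_le_ne_top ENNReal.ofReal_ne_top (le_trans ?_ ((le_elq hq0 _ k).trans hnorm))
    rw [htsum]
    refine le_mul_of_one_le_left' ?_
    rw [ENNReal.one_le_ofReal]
    exact (Real.one_le_rpow (one_le_jb k) hs.le).trans (hpow_ge k)
  · rw [wnorm, lqNorm_eq_elq]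
    refine (elq_mono fun k => ?_).trans hnorm
    rw [htsum, enorm_mul, enorm_norm,
      Real.enorm_of_nonneg (Real.rpow_nonneg (zero_le_one.trans (one_le_jb k)) s)]
    gcongr
    · exact hpow_ge k
    · exact enorm_tsum_le_tsum_enorm
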